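/- arXiv:2307.07455 — 3 statements merged into one kernel-verified Lean document; each statement's English description precedes it below -/
import Mathlib

section
/- Every expression that contains no occurrence of the conditional operators (· ⇒ · ◇ ·) and (· → · ◇ ·) is semantically equal (i.e., has the same value under every valuation) to some expression in simple conjunctive normal form, and also to some expression in simple disjunctive normal form. -/
namespace RESpaper

noncomputable section

/-- Addition on the extended reals in which `⊤` (i.e. `∞`) dominates. -/
def eadd (x y : EReal) : EReal := if x = ⊤ ∨ y = ⊤ then ⊤ else x + y

/-- The operator `eq-∞`. -/
def eqNegInfVal (x : EReal) : EReal := if x = ⊥ then ⊥ else ⊤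

/-- The operator `eq∞`. -/
def eqInfVal (x : EReal) : EReal := if x = ⊤ then ⊤ else ⊥

open Classical in
/-- The sum, with respect to `eadd`, of a finite family of extended reals. -/
def eSum {ι : Type*} (s : Finset ι) (e : ι → EReal) : EReal :=
  if ∃ i ∈ s, e i = ⊤ then ⊤ else ∑ i ∈ s, e i

/-- Syntax of expressions over a set `V` of variables. -/
inductive Expr (V : Type*) where
  | var : V → Expr V
  | const : EReal → Expr V
  | scale : {c : ℝ // 0 < c} → Expr V → Expr V
  | add : Expr V → Expr V → Expr V
  | emin : Expr V → Expr V → Expr V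
  | emax : Expr V → Expr V → Expr V
  | condL : Expr V → Expr V → Expr V → Expr V   -- (e₁ ⇒ e₂ ◇ e₃)
  | condR : Expr V → Expr V → Expr V → Expr V   -- (e₁ → e₂ ◇ e₃)
  | eqm : Expr V → Expr V                       -- eq-∞(e)

variable {V : Type*}

/-- Evaluation of an expression under a valuation `η`. -/
def Expr.eval (η : V → EReal) : Expr V → EReal
  | var X => η X
  | const d => d
  | scale c e => (c.1 : EReal) * Expr.eval η e
  | add e₁ e₂ => eadd (Expr.eval η e₁) (Expr.eval η e₂)
  | emin e₁ e₂ => Expr.eval η e₁ ⊓ Expr.eval η e₂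
  | emax e₁ e₂ => Expr.eval η e₁ ⊔ Expr.eval η e₂
  | condL e₁ e₂ e₃ =>
      if Expr.eval η e₁ ≤ 0 then Expr.eval η e₂ ⊓ Expr.eval η e₃ else Expr.eval η e₃
  | condR e₁ e₂ e₃ =>
      if Expr.eval η e₁ < 0 then Expr.eval η e₂ else Expr.eval η e₂ ⊔ Expr.eval η e₃
  | eqm e => eqNegInfVal (Expr.eval η e)

/-- The set of variables occurring in an expression. -/
def Expr.occ : Expr V → Set V
  | var X => {X}
  | const _ => ∅
  | scale _ e => Expr.occ e
  | add e₁ e₂ => Expr.occ e₁ ∪ Expr.occ e₂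
  | emin e₁ e₂ => Expr.occ e₁ ∪ Expr.occ e₂
  | emax e₁ e₂ => Expr.occ e₁ ∪ Expr.occ e₂
  | condL e₁ e₂ e₃ => Expr.occ e₁ ∪ Expr.occ e₂ ∪ Expr.occ e₃
  | condR e₁ e₂ e₃ => Expr.occ e₁ ∪ Expr.occ e₂ ∪ Expr.occ e₃
  | eqm e => Expr.occ e

/-- `e` contains no occurrence of the conditional operators. -/
def Expr.noCond : Expr V → Prop
  | var _ => True
  | const _ => True
  | scale _ e => Expr.noCond e
  | add e₁ e₂ => Expr.noCond e₁ ∧ Expr.noCond e₂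
  | emin e₁ e₂ => Expr.noCond e₁ ∧ Expr.noCond e₂
  | emax e₁ e₂ => Expr.noCond e₁ ∧ Expr.noCond e₂
  | condL _ _ _ => False
  | condR _ _ _ => False
  | eqm e => Expr.noCond e

/-- Syntactic substitution `e[X := g]`. -/
def Expr.subst [DecidableEq V] (X : V) (g : Expr V) : Expr V → Expr V
  | var Y => if Y = X then g else var Y
  | const d => const d
  | scale c e => scale c (Expr.subst X g e)
  | add e₁ e₂ => add (Expr.subst X g e₁) (Expr.subst X g e₂)
  | emin e₁ e₂ => emin (Expr.subst X g e₁) (Expr.subst X g e₂)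
  | emax e₁ e₂ => emax (Expr.subst X g e₁) (Expr.subst X g e₂)
  | condL e₁ e₂ e₃ => condL (Expr.subst X g e₁) (Expr.subst X g e₂) (Expr.subst X g e₃)
  | condR e₁ e₂ e₃ => condR (Expr.subst X g e₁) (Expr.subst X g e₂) (Expr.subst X g e₃)
  | eqm e => eqm (Expr.subst X g e)

/-- `(Σ_{(c,X) ∈ cs} c·X) + rest`. -/
def scaledSum (cs : List ({c : ℝ // 0 < c} × V)) (rest : Expr V) : Expr V :=
  cs.foldr (fun p acc => Expr.add (Expr.scale p.1 (Expr.var p.2)) acc) rest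

/-- `(Σ_{X ∈ ms} eq-∞(X)) + rest`. -/
def eqmSum (ms : List V) (rest : Expr V) : Expr V :=
  ms.foldr (fun X acc => Expr.add (Expr.eqm (Expr.var X)) acc) rest

/-- A term of the shape `(Σ_{X∈𝒳'} c^X·X) + (Σ_{X∈𝒳''} eq-∞(X)) + d`
with the variables in each of the two sums pairwise distinct. -/
def IsSimpleTerm (e : Expr V) : Prop :=
  ∃ (cs : List ({c : ℝ // 0 < c} × V)) (ms : List V) (d : EReal),
    (cs.map Prod.snd).Nodup ∧ ms.Nodup ∧ e = scaledSum cs (eqmSum ms (Expr.const d))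

/-- Finite disjunction; the empty disjunction is `−∞`. -/
def disjList : List (Expr V) → Expr V
  | [] => Expr.const ⊥
  | [e] => e
  | e :: es => Expr.emax e (disjList es)

/-- Finite conjunction; the empty conjunction is `∞`. -/
def conjList : List (Expr V) → Expr V
  | [] => Expr.const ⊤
  | [e] => e
  | e :: es => Expr.emin e (conjList es)

/-- Simple conjunctive normal form. -/
def IsSimpleCNF (e : Expr V) : Prop :=
  ∃ ls : List (List (Expr V)),
    (∀ l ∈ ls, ∀ t ∈ l, IsSimpleTerm t) ∧ e = conjList (ls.map disjList)

/-- Simple disjunctive normal form. -/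
def IsSimpleDNF (e : Expr V) : Prop :=
  ∃ ls : List (List (Expr V)),
    (∀ l ∈ ls, ∀ t ∈ l, IsSimpleTerm t) ∧ e = disjList (ls.map conjList)

/-- Conjunctive normal form. -/
inductive IsCNF : Expr V → Prop where
  | simple {e : Expr V} : IsSimpleCNF e → IsCNF e
  | condL {e₁ e₂ e₃ : Expr V} :
      IsSimpleCNF e₁ → IsCNF e₂ → IsCNF e₃ → IsCNF (Expr.condL e₁ e₂ e₃)
  | condR {e₁ e₂ e₃ : Expr V} :
      IsSimpleCNF e₁ → IsCNF e₂ → IsCNF e₃ → IsCNF (Expr.condR e₁ e₂ e₃)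

/-- Disjunctive normal form. -/
inductive IsDNF : Expr V → Prop where
  | simple {e : Expr V} : IsSimpleDNF e → IsDNF e
  | condL {e₁ e₂ e₃ : Expr V} :
      IsSimpleDNF e₁ → IsDNF e₂ → IsDNF e₃ → IsDNF (Expr.condL e₁ e₂ e₃)
  | condR {e₁ e₂ e₃ : Expr V} :
      IsSimpleDNF e₁ → IsDNF e₂ → IsDNF e₃ → IsDNF (Expr.condR e₁ e₂ e₃)

/-- Fixed-point symbols. -/
inductive FP where
  | mu : FP
  | nu : FP

/-- A real equation system: a finite sequence of fixed-point equations `σ X = e`. -/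
abbrev RES (V : Type*) := List (FP × V × Expr V)

/-- The bound variables of a RES. -/
def bnd (E : RES V) : List V := E.map (fun p => p.2.1)

variable [DecidableEq V]

/-- The solution `[[ℰ]]η` of a real equation system. -/
def sol : RES V → (V → EReal) → V → EReal
  | [], η => η
  | (FP.mu, X, e) :: E, η =>
      sol E (Function.update η X
        (sInf {r : EReal | Expr.eval (sol E (Function.update η X r)) e ≤ r}))
  | (FP.nu, X, e) :: E, η =>
      sol E (Function.update η X
        (sSup {r : EReal | r ≤ Expr.eval (sol E (Function.update η X r)) e}))

/-- Equivalence of real equation systems. -/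
def REquiv (E E' : RES V) : Prop :=
  ∀ F : RES V, (∀ Y ∈ bnd F, Y ∉ bnd E ∧ Y ∉ bnd E') →
    ∀ η : V → EReal, sol (E ++ F) η = sol (E' ++ F) η

theorem eadd_comm (x y : EReal) : eadd x y = eadd y x := by
  simp only [eadd, or_comm, add_comm]

theorem eadd_assoc (x y z : EReal) : eadd (eadd x y) z = eadd x (eadd y z) := by
  induction x <;> induction y <;> induction z <;> simp [eadd, ← EReal.coe_add, add_assoc]

theorem eadd_left_comm (x y z : EReal) : eadd x (eadd y z) = eadd y (eadd x z) := by
  rw [← eadd_assoc, eadd_comm x y, eadd_assoc]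

theorem eadd_zero (x : EReal) : eadd x 0 = x := by
  induction x <;> simp [eadd]

theorem eadd_mono_right (x : EReal) : Monotone (eadd x) := by
  intro y z h
  unfold eadd
  split_ifs with h₁ h₂
  · exact le_rfl
  · rcases h₁ with rfl | rfl <;> simp_all
  · exact le_top
  · exact add_le_add_right h x

theorem coe_mul_eadd {c : ℝ} (hc : 0 < c) (x y : EReal) :
    (c : EReal) * eadd x y = eadd (c * x) (c * y) := by
  induction x <;> induction y <;>
    simp [eadd, ← EReal.coe_add, ← EReal.coe_mul, mul_add, EReal.coe_mul_top_of_pos,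
      EReal.coe_mul_bot_of_pos, hc]

theorem coe_add_mul_eq_eadd {c d : ℝ} (hc : 0 < c) (hd : 0 < d) (x : EReal) :
    ((c + d : ℝ) : EReal) * x = eadd (c * x) (d * x) := by
  induction x with
  | bot => simp only [eadd, EReal.coe_mul_bot_of_pos, hc, hd, add_pos]; simp
  | top => simp only [eadd, EReal.coe_mul_top_of_pos, hc, hd, add_pos]; simp
  | coe x => simp only [eadd, ← EReal.coe_mul, ← EReal.coe_add, add_mul]; simp [-EReal.coe_mul]

theorem coe_mul_mono {c : ℝ} (hc : 0 < c) : Monotone fun x : EReal => (c : EReal) * x :=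
  fun _ _ h => mul_le_mul_of_nonneg_left h (EReal.coe_nonneg.2 hc.le)

theorem eqNegInfVal_mono : Monotone eqNegInfVal := by
  intro x y h
  unfold eqNegInfVal
  split_ifs <;> simp_all

theorem eqNegInfVal_eadd (x y : EReal) :
    eqNegInfVal (eadd x y) =
      (eqNegInfVal x ⊓ eqNegInfVal y) ⊔ (eadd ⊥ x ⊔ eadd ⊥ y) := by
  induction x <;> induction y <;> simp [eadd, eqNegInfVal, -EReal.coe_add, ← EReal.coe_add]

theorem eqNegInfVal_eqNegInfVal (x : EReal) : eqNegInfVal (eqNegInfVal x) = eqNegInfVal x := by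
  by_cases h : x = ⊥ <;> simp [eqNegInfVal, h]

theorem eadd_eqNegInfVal_self (x : EReal) :
    eadd (eqNegInfVal x) (eqNegInfVal x) = eqNegInfVal x := by
  by_cases h : x = ⊥ <;> simp [eqNegInfVal, eadd, h]

theorem coe_mul_eqNegInfVal {c : ℝ} (hc : 0 < c) (x : EReal) :
    (c : EReal) * eqNegInfVal x = eqNegInfVal x := by
  unfold eqNegInfVal
  split_ifs <;> simp [EReal.coe_mul_top_of_pos, EReal.coe_mul_bot_of_pos, hc]

theorem eqNegInfVal_coe_mul {c : ℝ} (hc : 0 < c) (x : EReal) :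
    eqNegInfVal ((c : EReal) * x) = eqNegInfVal x := by
  induction x with
  | bot => simp [EReal.coe_mul_bot_of_pos, hc]
  | top => simp [EReal.coe_mul_top_of_pos, hc]
  | coe x => rw [← EReal.coe_mul]; simp only [eqNegInfVal, EReal.coe_ne_bot]

section NormalForms

variable {U : Type*}

/-- The functions on valuations that are the value of an expression satisfying `P`. -/
def realized (P : Expr U → Prop) : Set ((U → EReal) → EReal) :=
  {f | ∃ e, P e ∧ ∀ η, Expr.eval η e = f η}

theorem eval_scaledSum (cs : List ({c : ℝ // 0 < c} × U)) (r : Expr U) (η : U → EReal) :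
    Expr.eval η (scaledSum cs r) =
      eadd (Expr.eval η (scaledSum cs (Expr.const 0))) (Expr.eval η r) := by
  induction cs with
  | nil => simp [scaledSum, Expr.eval, eadd_comm 0, eadd_zero]
  | cons p cs ih =>
    simp only [scaledSum, List.foldr_cons, Expr.eval] at ih ⊢
    rw [ih, eadd_assoc]

theorem eval_eqmSum (ms : List U) (r : Expr U) (η : U → EReal) :
    Expr.eval η (eqmSum ms r) =
      eadd (Expr.eval η (eqmSum ms (Expr.const 0))) (Expr.eval η r) := by
  induction ms with
  | nil => simp [eqmSum, Expr.eval, eadd_comm 0, eadd_zero]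
  | cons X ms ih =>
    simp only [eqmSum, List.foldr_cons, Expr.eval] at ih ⊢
    rw [ih, eadd_assoc]

theorem exists_scaledSum_insert (c : {c : ℝ // 0 < c}) (X : U)
    (cs : List ({c : ℝ // 0 < c} × U)) (hcs : (cs.map Prod.snd).Nodup) :
    ∃ cs' : List ({c : ℝ // 0 < c} × U), (cs'.map Prod.snd).Nodup ∧
      (∀ Y, Y ∈ cs'.map Prod.snd ↔ Y = X ∨ Y ∈ cs.map Prod.snd) ∧
      ∀ (η : U → EReal) (r : Expr U), Expr.eval η (scaledSum cs' r) =
        eadd ((c.1 : EReal) * η X) (Expr.eval η (scaledSum cs r)) := by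
  induction cs with
  | nil => exact ⟨[(c, X)], by simp, by simp, fun η r => by simp [scaledSum, Expr.eval]⟩
  | cons p cs ih =>
    rw [List.map_cons, List.nodup_cons] at hcs
    obtain ⟨d, Y⟩ := p
    by_cases h : Y = X
    · subst h
      refine ⟨(⟨c.1 + d.1, add_pos c.2 d.2⟩, Y) :: cs, ?_, ?_, fun η r => ?_⟩
      · simpa using hcs
      · simp
      · simp only [scaledSum, List.foldr_cons, Expr.eval]
        rw [coe_add_mul_eq_eadd c.2 d.2, eadd_assoc]
    · obtain ⟨cs', hnd, hmem, heval⟩ := ih hcs.2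
      refine ⟨(d, Y) :: cs', ?_, fun Z => ?_, fun η r => ?_⟩
      · rw [List.map_cons, List.nodup_cons, hmem]
        exact ⟨not_or.2 ⟨h, hcs.1⟩, hnd⟩
      · rw [List.map_cons, List.mem_cons, hmem, List.map_cons, List.mem_cons, or_left_comm]
      · have := heval η r
        simp only [scaledSum, List.foldr_cons, Expr.eval] at this ⊢
        rw [this, eadd_left_comm]

theorem exists_eqmSum_insert (X : U) (ms : List U) (hms : ms.Nodup) :
    ∃ ms' : List U, ms'.Nodup ∧ ∀ (η : U → EReal) (r : Expr U),
      Expr.eval η (eqmSum ms' r) =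
        eadd (eqNegInfVal (η X)) (Expr.eval η (eqmSum ms r)) := by
  by_cases h : X ∈ ms
  · refine ⟨ms, hms, fun η r => ?_⟩
    clear hms
    induction ms with
    | nil => simp at h
    | cons Y ms ih =>
      simp only [eqmSum, List.foldr_cons, Expr.eval] at ih ⊢
      rcases List.mem_cons.1 h with rfl | h
      · rw [← eadd_assoc, eadd_eqNegInfVal_self]
      · rw [eadd_left_comm, ← ih h]
  · exact ⟨X :: ms, List.nodup_cons.2 ⟨h, hms⟩, fun η r => by simp [eqmSum, Expr.eval]⟩

theorem const_mem_realized (d : EReal) : (fun _ => d) ∈ realized (U := U) IsSimpleTerm :=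
  ⟨Expr.const d, ⟨[], [], d, by simp, by simp, rfl⟩, fun _ => rfl⟩

theorem const_eadd_mem_realized (d : EReal) {f : (U → EReal) → EReal}
    (hf : f ∈ realized IsSimpleTerm) : (fun η => eadd d (f η)) ∈ realized IsSimpleTerm := by
  obtain ⟨_, ⟨cs, ms, d', hcs, hms, rfl⟩, hf⟩ := hf
  refine ⟨_, ⟨cs, ms, eadd d d', hcs, hms, rfl⟩, fun η => ?_⟩
  beta_reduce
  rw [← hf, eval_scaledSum, eval_eqmSum, eval_scaledSum cs (eqmSum ms (.const d')),
    eval_eqmSum ms (.const d')]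
  simp only [Expr.eval]
  rw [eadd_left_comm _ d, eadd_left_comm _ d]

theorem scale_eadd_mem_realized (c : {c : ℝ // 0 < c}) (X : U) {f : (U → EReal) → EReal}
    (hf : f ∈ realized IsSimpleTerm) :
    (fun η => eadd ((c.1 : EReal) * η X) (f η)) ∈ realized IsSimpleTerm := by
  obtain ⟨_, ⟨cs, ms, d, hcs, hms, rfl⟩, hf⟩ := hf
  obtain ⟨cs', hcs', -, h⟩ := exists_scaledSum_insert c X cs hcs
  exact ⟨_, ⟨cs', ms, d, hcs', hms, rfl⟩, fun η => by rw [h, hf]⟩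

theorem eqm_eadd_mem_realized (X : U) {f : (U → EReal) → EReal}
    (hf : f ∈ realized IsSimpleTerm) :
    (fun η => eadd (eqNegInfVal (η X)) (f η)) ∈ realized IsSimpleTerm := by
  obtain ⟨_, ⟨cs, ms, d, hcs, hms, rfl⟩, hf⟩ := hf
  obtain ⟨ms', hms', h⟩ := exists_eqmSum_insert X ms hms
  refine ⟨_, ⟨cs, ms', d, hcs, hms', rfl⟩, fun η => ?_⟩
  rw [eval_scaledSum, h, eadd_left_comm, ← eval_scaledSum, hf]

/-- Induction principle for the functions denoted by simple terms. -/
theorem realized_term_induction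
    {p : (f : (U → EReal) → EReal) → f ∈ realized IsSimpleTerm → Prop}
    (const : ∀ d : EReal, p (fun _ => d) (const_mem_realized d))
    (scale : ∀ (c : {c : ℝ // 0 < c}) (X : U) (f : (U → EReal) → EReal)
      (hf : f ∈ realized IsSimpleTerm), p f hf →
        p (fun η => eadd ((c.1 : EReal) * η X) (f η)) (scale_eadd_mem_realized c X hf))
    (eqm : ∀ (X : U) (f : (U → EReal) → EReal) (hf : f ∈ realized IsSimpleTerm), p f hf →
      p (fun η => eadd (eqNegInfVal (η X)) (f η)) (eqm_eadd_mem_realized X hf))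
    {f : (U → EReal) → EReal} (hf : f ∈ realized IsSimpleTerm) : p f hf := by
  obtain ⟨cs, ms, d, hcs, hms, rfl⟩ : ∃ (cs : List ({c : ℝ // 0 < c} × U)) (ms : List U)
      (d : EReal), (cs.map Prod.snd).Nodup ∧ ms.Nodup ∧
        (fun η => Expr.eval η (scaledSum cs (eqmSum ms (.const d)))) = f := by
    obtain ⟨_, ⟨cs, ms, d, hcs, hms, rfl⟩, hf⟩ := hf
    exact ⟨cs, ms, d, hcs, hms, funext hf⟩
  induction cs with
  | nil =>
    induction ms with
    | nil => exact const d
    | cons X ms ih =>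
      have hms' := (List.nodup_cons.1 hms).2
      exact eqm X _ ⟨_, ⟨[], ms, d, hcs, hms', rfl⟩, fun _ => rfl⟩ (ih hms' _)
  | cons q cs ih =>
    have hcs' := (List.nodup_cons.1 hcs).2
    exact scale q.1 q.2 _ ⟨_, ⟨cs, ms, d, hcs', hms, rfl⟩, fun _ => rfl⟩ (ih hcs' _)

theorem eadd_mem_realized {f g : (U → EReal) → EReal} (hf : f ∈ realized IsSimpleTerm)
    (hg : g ∈ realized IsSimpleTerm) : (fun η => eadd (f η) (g η)) ∈ realized IsSimpleTerm := by
  induction hf using realized_term_induction with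
  | const d => exact const_eadd_mem_realized d hg
  | scale c X f _ ih => simpa only [eadd_assoc] using scale_eadd_mem_realized c X ih
  | eqm X f _ ih => simpa only [eadd_assoc] using eqm_eadd_mem_realized X ih

theorem scale_mem_realized (c : {c : ℝ // 0 < c}) {f : (U → EReal) → EReal}
    (hf : f ∈ realized IsSimpleTerm) :
    (fun η => (c.1 : EReal) * f η) ∈ realized IsSimpleTerm := by
  induction hf using realized_term_induction with
  | const d => exact const_mem_realized _
  | scale d X f _ ih =>
    simpa only [coe_mul_eadd c.2, ← mul_assoc, ← EReal.coe_mul] using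
      scale_eadd_mem_realized ⟨c.1 * d.1, mul_pos c.2 d.2⟩ X ih
  | eqm X f _ ih =>
    simpa only [coe_mul_eadd c.2, coe_mul_eqNegInfVal c.2] using eqm_eadd_mem_realized X ih

theorem eqm_var_mem_realized (X : U) :
    (fun η => eqNegInfVal (η X)) ∈ realized IsSimpleTerm := by
  simpa only [eadd_zero] using eqm_eadd_mem_realized X (const_mem_realized 0)

theorem scale_var_mem_realized (c : {c : ℝ // 0 < c}) (X : U) :
    (fun η => (c.1 : EReal) * η X) ∈ realized IsSimpleTerm := by
  simpa only [eadd_zero] using scale_eadd_mem_realized c X (const_mem_realized 0)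

theorem comp_mem_latticeClosure {φ : EReal → EReal} (hφ : Monotone φ)
    {S : Set ((U → EReal) → EReal)} (hS : ∀ f ∈ S, (fun η => φ (f η)) ∈ latticeClosure S)
    {f : (U → EReal) → EReal} (hf : f ∈ latticeClosure S) :
    (fun η => φ (f η)) ∈ latticeClosure S := by
  induction hf using latticeClosure_sup_inf_induction with
  | mem f hf => exact hS f hf
  | sup f _ g _ hf hg =>
    simp only [Pi.sup_apply, hφ.map_sup]
    exact isSublattice_latticeClosure.supClosed hf hg
  | inf f _ g _ hf hg =>
    simp only [Pi.inf_apply, hφ.map_inf]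
    exact isSublattice_latticeClosure.infClosed hf hg

theorem eadd_mem_latticeClosure {S : Set ((U → EReal) → EReal)}
    (hS : ∀ f ∈ S, ∀ g ∈ S, (fun η => eadd (f η) (g η)) ∈ S)
    {f g : (U → EReal) → EReal} (hf : f ∈ latticeClosure S) (hg : g ∈ latticeClosure S) :
    (fun η => eadd (f η) (g η)) ∈ latticeClosure S := by
  induction hf using latticeClosure_sup_inf_induction with
  | mem f hf =>
    induction hg using latticeClosure_sup_inf_induction with
    | mem g hg => exact subset_latticeClosure (hS f hf g hg)
    | sup g _ g' _ hg hg' =>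
      simp only [Pi.sup_apply, (eadd_mono_right _).map_sup]
      exact isSublattice_latticeClosure.supClosed hg hg'
    | inf g _ g' _ hg hg' =>
      simp only [Pi.inf_apply, (eadd_mono_right _).map_inf]
      exact isSublattice_latticeClosure.infClosed hg hg'
  | sup f _ f' _ hf hf' =>
    simp only [eadd_comm _ (g _)] at hf hf' ⊢
    simp only [Pi.sup_apply, (eadd_mono_right _).map_sup]
    exact isSublattice_latticeClosure.supClosed hf hf'
  | inf f _ f' _ hf hf' =>
    simp only [eadd_comm _ (g _)] at hf hf' ⊢
    simp only [Pi.inf_apply, (eadd_mono_right _).map_inf]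
    exact isSublattice_latticeClosure.infClosed hf hf'

theorem eqm_term_mem_latticeClosure {f : (U → EReal) → EReal}
    (hf : f ∈ realized IsSimpleTerm) :
    (fun η => eqNegInfVal (f η)) ∈ latticeClosure (realized IsSimpleTerm) := by
  have key : ∀ g h : (U → EReal) → EReal, g ∈ realized IsSimpleTerm → h ∈ realized IsSimpleTerm →
      (fun η => eqNegInfVal (g η)) ∈ latticeClosure (realized IsSimpleTerm) →
      (fun η => eqNegInfVal (h η)) ∈ latticeClosure (realized IsSimpleTerm) →
      (fun η => eqNegInfVal (eadd (g η) (h η))) ∈ latticeClosure (realized IsSimpleTerm) := by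
    intro g h hg hh hg' hh'
    simp only [eqNegInfVal_eadd]
    have hL := isSublattice_latticeClosure (s := realized (U := U) IsSimpleTerm)
    exact hL.supClosed (hL.infClosed hg' hh')
      (hL.supClosed (subset_latticeClosure (const_eadd_mem_realized ⊥ hg))
        (subset_latticeClosure (const_eadd_mem_realized ⊥ hh)))
  induction hf using realized_term_induction with
  | const d => exact subset_latticeClosure (const_mem_realized _)
  | scale c X f hf ih =>
    refine key _ _ (scale_var_mem_realized c X) hf ?_ ih
    simpa only [eqNegInfVal_coe_mul c.2] using subset_latticeClosure (eqm_var_mem_realized X)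
  | eqm X f hf ih =>
    refine key _ _ (eqm_var_mem_realized X) hf ?_ ih
    simpa only [eqNegInfVal_eqNegInfVal] using subset_latticeClosure (eqm_var_mem_realized X)

theorem eval_mem_latticeClosure (e : Expr U) (h : e.noCond) :
    (fun η => Expr.eval η e) ∈ latticeClosure (realized (U := U) IsSimpleTerm) := by
  induction e with
  | var X =>
    refine subset_latticeClosure ?_
    simpa only [Expr.eval, EReal.coe_one, one_mul] using scale_var_mem_realized ⟨1, one_pos⟩ X
  | const d => exact subset_latticeClosure (const_mem_realized d)
  | scale c e ih =>
    exact comp_mem_latticeClosure (coe_mul_mono c.2)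
      (fun f hf => subset_latticeClosure (scale_mem_realized c hf)) (ih h)
  | add e₁ e₂ ih₁ ih₂ =>
    exact eadd_mem_latticeClosure (fun f hf g hg => eadd_mem_realized hf hg) (ih₁ h.1) (ih₂ h.2)
  | emin e₁ e₂ ih₁ ih₂ => exact isSublattice_latticeClosure.infClosed (ih₁ h.1) (ih₂ h.2)
  | emax e₁ e₂ ih₁ ih₂ => exact isSublattice_latticeClosure.supClosed (ih₁ h.1) (ih₂ h.2)
  | condL => exact h.elim
  | condR => exact h.elim
  | eqm e ih =>
    exact comp_mem_latticeClosure eqNegInfVal_mono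
      (fun f hf => eqm_term_mem_latticeClosure hf) (ih h)

theorem eval_disjList_cons (η : U → EReal) (e : Expr U) (l : List (Expr U)) :
    Expr.eval η (disjList (e :: l)) = Expr.eval η e ⊔ Expr.eval η (disjList l) := by
  cases l <;> simp [disjList, Expr.eval]

theorem eval_conjList_cons (η : U → EReal) (e : Expr U) (l : List (Expr U)) :
    Expr.eval η (conjList (e :: l)) = Expr.eval η e ⊓ Expr.eval η (conjList l) := by
  cases l <;> simp [conjList, Expr.eval]

theorem eval_disjList_append (η : U → EReal) (l l' : List (Expr U)) :
    Expr.eval η (disjList (l ++ l')) = Expr.eval η (disjList l) ⊔ Expr.eval η (disjList l') := by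
  induction l with
  | nil => simp [disjList, Expr.eval]
  | cons e l ih => rw [List.cons_append, eval_disjList_cons, eval_disjList_cons, ih, sup_assoc]

theorem eval_conjList_append (η : U → EReal) (l l' : List (Expr U)) :
    Expr.eval η (conjList (l ++ l')) = Expr.eval η (conjList l) ⊓ Expr.eval η (conjList l') := by
  induction l with
  | nil => simp [conjList, Expr.eval]
  | cons e l ih => rw [List.cons_append, eval_conjList_cons, eval_conjList_cons, ih, inf_assoc]

theorem supClosure_realized_subset (P : Expr U → Prop) :
    supClosure (realized P) ⊆ realized fun e => ∃ l, (∀ t ∈ l, P t) ∧ e = disjList l := by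
  refine supClosure_min ?_ ?_
  · rintro f ⟨e, he, hf⟩
    exact ⟨e, ⟨[e], by simpa using he, rfl⟩, hf⟩
  · rintro f ⟨_, ⟨l, hl, rfl⟩, hf⟩ g ⟨_, ⟨l', hl', rfl⟩, hg⟩
    refine ⟨_, ⟨l ++ l', ?_, rfl⟩, fun η => ?_⟩
    · simpa only [List.forall_mem_append] using ⟨hl, hl'⟩
    · rw [eval_disjList_append, hf, hg, Pi.sup_apply]

theorem infClosure_realized_subset (P : Expr U → Prop) :
    infClosure (realized P) ⊆ realized fun e => ∃ l, (∀ t ∈ l, P t) ∧ e = conjList l := by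
  refine infClosure_min ?_ ?_
  · rintro f ⟨e, he, hf⟩
    exact ⟨e, ⟨[e], by simpa using he, rfl⟩, hf⟩
  · rintro f ⟨_, ⟨l, hl, rfl⟩, hf⟩ g ⟨_, ⟨l', hl', rfl⟩, hg⟩
    refine ⟨_, ⟨l ++ l', ?_, rfl⟩, fun η => ?_⟩
    · simpa only [List.forall_mem_append] using ⟨hl, hl'⟩
    · rw [eval_conjList_append, hf, hg, Pi.inf_apply]

theorem exists_map_eq_of_forall_mem {α β : Type*} {P : α → Prop} {φ : α → β} (l : List β)
    (h : ∀ b ∈ l, ∃ a, P a ∧ b = φ a) : ∃ l' : List α, (∀ a ∈ l', P a) ∧ l = l'.map φ := by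
  induction l with
  | nil => exact ⟨[], by simp, rfl⟩
  | cons b l ih =>
    rw [List.forall_mem_cons] at h
    obtain ⟨⟨a, ha, rfl⟩, h⟩ := h
    obtain ⟨l', hl', rfl⟩ := ih h
    exact ⟨a :: l', List.forall_mem_cons.2 ⟨ha, hl'⟩, rfl⟩

theorem latticeClosure_subset_realized_simpleCNF :
    latticeClosure (realized (U := U) IsSimpleTerm) ⊆ realized IsSimpleCNF := by
  rw [← infClosure_supClosure]
  refine (infClosure_mono (supClosure_realized_subset _)).trans
    ((infClosure_realized_subset _).trans ?_)
  rintro f ⟨_, ⟨l, hl, rfl⟩, hf⟩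
  obtain ⟨ls, hls, rfl⟩ := exists_map_eq_of_forall_mem l hl
  exact ⟨_, ⟨ls, hls, rfl⟩, hf⟩

theorem latticeClosure_subset_realized_simpleDNF :
    latticeClosure (realized (U := U) IsSimpleTerm) ⊆ realized IsSimpleDNF := by
  rw [← supClosure_infClosure]
  refine (supClosure_mono (infClosure_realized_subset _)).trans
    ((supClosure_realized_subset _).trans ?_)
  rintro f ⟨_, ⟨l, hl, rfl⟩, hf⟩
  obtain ⟨ls, hls, rfl⟩ := exists_map_eq_of_forall_mem l hl
  exact ⟨_, ⟨ls, hls, rfl⟩, hf⟩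

end NormalForms

/-- every conditional-free expression is semantically equal to a
simple conjunctive normal form and to a simple disjunctive normal form. -/
theorem simple_normal_form (e : Expr V) (h : e.noCond) :
    (∃ e' : Expr V, IsSimpleCNF e' ∧ ∀ η : V → EReal, Expr.eval η e' = Expr.eval η e) ∧
    (∃ e' : Expr V, IsSimpleDNF e' ∧ ∀ η : V → EReal, Expr.eval η e' = Expr.eval η e) := by
  exact ⟨latticeClosure_subset_realized_simpleCNF (eval_mem_latticeClosure e h),
    latticeClosure_subset_realized_simpleDNF (eval_mem_latticeClosure e h)⟩

end
end RESpaper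
end

section
/- For every real equation system ℰ, every expression e, and all valuations η and η' such that η(X) ≥ η'(X) for all X ∈ 𝒳, it holds that ([[ℰ]]η)(e) ≥ ([[ℰ]]η')(e). -/
namespace RESpaper

noncomputable section

variable {V : Type*}

variable [DecidableEq V]

theorem eadd_mono {x x' y y' : EReal} (hx : x ≤ x') (hy : y ≤ y') :
    eadd x y ≤ eadd x' y' := by
  by_cases h' : x' = ⊤ ∨ y' = ⊤
  · simp [eadd, h']
  · have h : ¬ (x = ⊤ ∨ y = ⊤) := fun h => h' <|
      h.imp (fun hxt : x = ⊤ => top_unique (hxt.ge.trans hx))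
        (fun hyt : y = ⊤ => top_unique (hyt.ge.trans hy))
    simpa only [eadd, if_neg h, if_neg h'] using add_le_add hx hy

theorem Expr.eval_mono {W : Type*} (e : Expr W) :
    Monotone fun η : W → EReal => Expr.eval η e := by
  intro η' η h
  induction e with
  | var X => exact h X
  | const d => exact le_rfl
  | scale c e ih => exact mul_le_mul_of_nonneg_left ih (EReal.coe_nonneg.2 c.2.le)
  | add e₁ e₂ ih₁ ih₂ => exact eadd_mono ih₁ ih₂
  | emin e₁ e₂ ih₁ ih₂ => exact inf_le_inf ih₁ ih₂
  | emax e₁ e₂ ih₁ ih₂ => exact sup_le_sup ih₁ ih₂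
  | condL e₁ e₂ e₃ ih₁ ih₂ ih₃ =>
    simp only [Expr.eval]
    split_ifs with h' h₁ h₁
    · exact inf_le_inf ih₂ ih₃
    · exact inf_le_right.trans ih₃
    · exact absurd (ih₁.trans h₁) h'
    · exact ih₃
  | condR e₁ e₂ e₃ ih₁ ih₂ ih₃ =>
    simp only [Expr.eval]
    split_ifs with h' h₁ h₁
    · exact ih₂
    · exact ih₂.trans le_sup_left
    · exact absurd (ih₁.trans_lt h₁) h'
    · exact sup_le_sup ih₂ ih₃
  | eqm e ih => exact eqNegInfVal_mono ih

theorem sol_mono (E : RES V) : Monotone (sol E) := by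
  induction E with
  | nil => exact monotone_id
  | cons p E ih =>
    obtain ⟨σ, X, e⟩ := p
    intro η' η h
    have eval_le (r : EReal) : Expr.eval (sol E (Function.update η' X r)) e ≤
        Expr.eval (sol E (Function.update η X r)) e :=
      e.eval_mono (ih (update_le_update_iff.2 ⟨le_rfl, fun Y _ => h Y⟩))
    cases σ with
    | mu =>
      exact ih (update_le_update_iff.2
        ⟨sInf_le_sInf fun r hr => (eval_le r).trans hr, fun Y _ => h Y⟩)
    | nu =>
      exact ih (update_le_update_iff.2
        ⟨sSup_le_sSup fun r hr => le_trans hr (eval_le r), fun Y _ => h Y⟩)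

/-- monotonicity of the solution of a RES in the valuation. -/
theorem sol_monotone (E : RES V) (e : Expr V) (η η' : V → EReal)
    (h : ∀ X : V, η' X ≤ η X) :
    Expr.eval (sol E η') e ≤ Expr.eval (sol E η) e :=
  e.eval_mono (sol_mono E h)

end
end RESpaper
end

section
/- Let X be a variable, e and f expressions, and σ either the minimal fixed-point symbol μ or the maximal fixed-point symbol ν. If [[σ X = e]]η = [[σ X = f]]η for every valuation η, then σ X = e ≡ σ X = f. -/
namespace RESpaper

noncomputable section

variable {V : Type*}

variable [DecidableEq V]

theorem sol_apply_of_notMem_bnd (E : RES V) {X : V} (hX : X ∉ bnd E) (η : V → EReal) :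
    sol E η X = η X := by
  induction E generalizing η with
  | nil => rfl
  | cons p E ih =>
    obtain ⟨σ, Y, e⟩ := p
    have hXY : X ≠ Y := fun h => hX (by simp [bnd, h])
    have hXE : X ∉ bnd E := fun h => hX (List.mem_cons_of_mem _ h)
    cases σ <;> simp only [sol, ih hXE, Function.update_of_ne hXY]

/-- Inequality of least fixed points along every line in direction `X` is inherited by
every monotone curve that is parametrized by its `X`-coordinate. -/
theorem sInf_prefixed_le_of_forall_update {α : Type*} [CompleteLattice α] {X : V}
    {φ ψ : (V → α) → α} (hψ : Monotone ψ)
    (h : ∀ η : V → α, sInf {r | ψ (Function.update η X r) ≤ r} ≤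
      sInf {r | φ (Function.update η X r) ≤ r})
    {g : α → V → α} (hg : Monotone g) (hgX : ∀ r, g r X = r) :
    sInf {r | ψ (g r) ≤ r} ≤ sInf {r | φ (g r) ≤ r} := by
  refine le_sInf fun a (ha : φ (g a) ≤ a) => ?_
  set b := sInf {r | ψ (Function.update (g a) X r) ≤ r}
  have hba : b ≤ a := (h (g a)).trans <| sInf_le <| by
    have : Function.update (g a) X a = g a :=
      Function.update_eq_self_iff.mpr (hgX a).symm
    simpa only [Set.mem_ofPred_eq, this] using ha
  have hψb : ψ (Function.update (g a) X b) ≤ b :=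
    le_sInf fun r hr => le_trans
      (hψ (update_le_update_iff.mpr ⟨sInf_le hr, fun _ _ => le_rfl⟩)) hr
  refine le_trans (sInf_le ?_) hba
  refine le_trans (hψ ?_) hψb
  exact le_update_iff.mpr ⟨(hgX b).le, fun Y _ => hg hba Y⟩

theorem sSup_postfixed_le_of_forall_update {α : Type*} [CompleteLattice α] {X : V}
    {φ ψ : (V → α) → α} (hψ : Monotone ψ)
    (h : ∀ η : V → α, sSup {r | r ≤ φ (Function.update η X r)} ≤
      sSup {r | r ≤ ψ (Function.update η X r)})
    {g : α → V → α} (hg : Monotone g) (hgX : ∀ r, g r X = r) :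
    sSup {r | r ≤ φ (g r)} ≤ sSup {r | r ≤ ψ (g r)} := by
  refine sSup_le fun a (ha : a ≤ φ (g a)) => ?_
  set b := sSup {r | r ≤ ψ (Function.update (g a) X r)}
  have hab : a ≤ b := le_trans (le_sSup <| by
    have : Function.update (g a) X a = g a :=
      Function.update_eq_self_iff.mpr (hgX a).symm
    simpa only [Set.mem_ofPred_eq, this] using ha) (h (g a))
  have hψb : b ≤ ψ (Function.update (g a) X b) :=
    sSup_le fun r hr => le_trans hr
      (hψ (update_le_update_iff.mpr ⟨le_sSup hr, fun _ _ => le_rfl⟩))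
  refine le_trans hab (le_sSup ?_)
  refine le_trans hψb (hψ ?_)
  exact update_le_iff.mpr ⟨(hgX b).ge, fun Y _ => hg hab Y⟩

/-- if two single equations with the same fixed-point symbol have
the same solution under every valuation, then they are equivalent. -/
theorem nocontext (X : V) (e f : Expr V) (σ : FP)
    (h : ∀ η : V → EReal, sol [(σ, X, e)] η = sol [(σ, X, f)] η) :
    REquiv [(σ, X, e)] [(σ, X, f)] := by
  intro F hF η
  have hX : X ∉ bnd F := fun hXF => (hF X hXF).1 (by simp [bnd])
  have hg : Monotone fun r => sol F (Function.update η X r) := fun r s hrs =>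
    sol_mono F (update_le_update_iff.mpr ⟨hrs, fun _ _ => le_rfl⟩)
  have hgX (r : EReal) : sol F (Function.update η X r) X = r := by
    rw [sol_apply_of_notMem_bnd F hX, Function.update_self]
  cases σ with
  | mu =>
    have h' (η : V → EReal) := congrFun (h η) X
    simp only [sol, Function.update_self] at h'
    simp only [List.cons_append, List.nil_append, sol]
    congr 2
    exact le_antisymm
      (sInf_prefixed_le_of_forall_update (φ := fun η => Expr.eval η f) e.eval_mono
        (fun η => (h' η).le) hg hgX)
      (sInf_prefixed_le_of_forall_update (φ := fun η => Expr.eval η e) f.eval_mono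
        (fun η => (h' η).ge) hg hgX)
  | nu =>
    have h' (η : V → EReal) := congrFun (h η) X
    simp only [sol, Function.update_self] at h'
    simp only [List.cons_append, List.nil_append, sol]
    congr 2
    exact le_antisymm
      (sSup_postfixed_le_of_forall_update (φ := fun η => Expr.eval η e) f.eval_mono
        (fun η => (h' η).le) hg hgX)
      (sSup_postfixed_le_of_forall_update (φ := fun η => Expr.eval η f) e.eval_mono
        (fun η => (h' η).ge) hg hgX)

end
end RESpaper
end
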